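/- arXiv:1902.00996 — 7 statements merged into one kernel-verified Lean document; each statement's English description precedes it below -/
import Mathlib

section
/- Let d ≥ 1, let L ≥ 0, let H be a d×d real symmetric matrix with −L·I_d ⪯ H ⪯ L·I_d, and let a, b, α, β, σ be real numbers. Suppose that for each of the two values Λ = L and Λ = −L one has (a/2)·Λ ≤ α + σ and (b²/4)·Λ² + ((a/2)·α − b·β)·Λ + β² − α·σ ≤ 0. Then the 2d×2d block matrix M̂ = [[α·I_d, β·I_d − (b/2)·H], [β·I_d − (b/2)·H, σ·I_d − (a/2)·H]] is positive semidefinite. -/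
open Matrix

/-- A real symmetric `2 × 2` matrix with nonnegative trace and determinant is positive
semidefinite. -/
lemma posSemidef_two_of_trace_det {p q r : ℝ} (htr : 0 ≤ p + r) (hdet : q ^ 2 ≤ p * r) :
    (!![p, q; q, r] : Matrix (Fin 2) (Fin 2) ℝ).PosSemidef := by
  refine PosSemidef.of_dotProduct_mulVec_nonneg ?_ fun v ↦ ?_
  · ext i j
    fin_cases i <;> fin_cases j <;> simp
  · have key : star v ⬝ᵥ !![p, q; q, r] *ᵥ v =
        p * v 0 ^ 2 + 2 * q * (v 0 * v 1) + r * v 1 ^ 2 := by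
      simp [dotProduct, mulVec, Fin.sum_univ_two]
      ring
    rw [key]
    rcases htr.eq_or_lt with h | h
    · obtain rfl : r = -p := by linarith
      have hp : p = 0 := by nlinarith [sq_nonneg p, sq_nonneg q]
      subst hp
      have hq : q = 0 := by nlinarith [sq_nonneg q]
      simp [hq]
    · refine nonneg_of_mul_nonneg_right ?_ h
      have : (p + r) * (p * v 0 ^ 2 + 2 * q * (v 0 * v 1) + r * v 1 ^ 2) =
          (p * v 0 + q * v 1) ^ 2 + (q * v 0 + r * v 1) ^ 2 +
            (p * r - q ^ 2) * (v 0 ^ 2 + v 1 ^ 2) := by ring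
      rw [this]
      have := sub_nonneg.2 hdet
      positivity

/-- The Kronecker product of a positive semidefinite `2 × 2` matrix with a positive semidefinite
matrix, in block form. -/
lemma posSemidef_fromBlocks_smul {n : Type*} [Fintype n] {P : Matrix n n ℝ} (hP : P.PosSemidef)
    {p q r : ℝ} (htr : 0 ≤ p + r) (hdet : q ^ 2 ≤ p * r) :
    (fromBlocks (p • P) (q • P) (q • P) (r • P)).PosSemidef := by
  have heq : fromBlocks (p • P) (q • P) (q • P) (r • P) =
      (kroneckerMap (· * ·) !![p, q; q, r] P).submatrix
        (Sum.elim (Prod.mk 0) (Prod.mk 1)) (Sum.elim (Prod.mk 0) (Prod.mk 1)) := by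
    ext (i | i) (j | j) <;> simp
  rw [heq]
  exact ((posSemidef_two_of_trace_det htr hdet).kronecker hP).submatrix _

/-- Eigenvalue criterion for positive semidefiniteness of the block matrix
`[[α·I, β·I − (b/2)·H], [β·I − (b/2)·H, σ·I − (a/2)·H]]` appearing in the
hypocoercivity analysis of the underdamped Langevin dynamics. -/
theorem blockMatrix_posSemidef {d : ℕ} (hd : 1 ≤ d) (L : ℝ) (hL : 0 ≤ L)
    (H : Matrix (Fin d) (Fin d) ℝ) (hHsymm : H.IsSymm)
    (hHub : (L • (1 : Matrix (Fin d) (Fin d) ℝ) - H).PosSemidef)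
    (hHlb : (H + L • (1 : Matrix (Fin d) (Fin d) ℝ)).PosSemidef)
    (a b α β σ : ℝ)
    (hlin : ∀ Λ : ℝ, (Λ = L ∨ Λ = -L) → (a / 2) * Λ ≤ α + σ)
    (hquad : ∀ Λ : ℝ, (Λ = L ∨ Λ = -L) →
      (b ^ 2 / 4) * Λ ^ 2 + ((a / 2) * α - b * β) * Λ + β ^ 2 - α * σ ≤ 0) :
    (Matrix.fromBlocks
      (α • (1 : Matrix (Fin d) (Fin d) ℝ)) (β • (1 : Matrix (Fin d) (Fin d) ℝ) - (b / 2) • H)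
      (β • (1 : Matrix (Fin d) (Fin d) ℝ) - (b / 2) • H)
      (σ • (1 : Matrix (Fin d) (Fin d) ℝ) - (a / 2) • H)).PosSemidef := by
  have htr (Λ : ℝ) (hΛ : Λ = L ∨ Λ = -L) : 0 ≤ α + (σ - a / 2 * Λ) := by
    linarith [hlin Λ hΛ]
  have hdet (Λ : ℝ) (hΛ : Λ = L ∨ Λ = -L) :
      (β - b / 2 * Λ) ^ 2 ≤ α * (σ - a / 2 * Λ) := by
    linarith [hquad Λ hΛ]
  rcases hL.eq_or_lt with rfl | hpos
  · have hH : H = 0 := by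
      simp only [zero_smul, zero_sub, add_zero] at hHub hHlb
      have h := hHub.trace_nonneg
      rw [trace_neg] at h
      exact hHlb.trace_eq_zero_iff.1 (by linarith [hHlb.trace_nonneg])
    have := posSemidef_fromBlocks_smul (PosSemidef.one (n := Fin d) (R := ℝ))
      (htr 0 (.inl rfl)) (hdet 0 (.inl rfl))
    simpa [hH] using this
  · have h := ((posSemidef_fromBlocks_smul hHlb (htr L (.inl rfl)) (hdet L (.inl rfl))).add
      (posSemidef_fromBlocks_smul hHub (htr (-L) (.inr rfl)) (hdet (-L) (.inr rfl)))).smul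
      (show 0 ≤ (2 * L)⁻¹ by positivity)
    convert h using 1
    rw [fromBlocks_add, fromBlocks_smul]
    congr 1 <;>
    · ext i j
      simp only [Matrix.smul_apply, Matrix.sub_apply, Matrix.add_apply, smul_eq_mul]
      field_simp
      ring
end

section
/- Let d ≥ 1, let L_G > 0 and 0 < ρ ≤ L_G, and let H be a d×d real symmetric matrix with −L_G·I_d ⪯ H ⪯ L_G·I_d. Define the 2d×2d block matrix M_C = [[I_d, 4·I_d − (1/(8L_G))·H], [4·I_d − (1/(8L_G))·H, 18·I_d − (1/(2L_G))·H]]. Then M_C ⪰ (ρ/10)·(S + (1/(2ρ))·I_{2d}). -/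
open Matrix

/-- The Kronecker product of a positive semidefinite `2 × 2` matrix with positive diagonal entry `a`
and a positive semidefinite matrix `P`, written in blocks, is positive semidefinite. -/
theorem Matrix.PosSemidef.fromBlocks_smul {n : Type*} [Fintype n] [DecidableEq n]
    {P : Matrix n n ℝ} (hP : P.PosSemidef) {a b c : ℝ} (ha : 0 < a) (h : b ^ 2 ≤ a * c) :
    (fromBlocks (a • P) (b • P) (b • P) (c • P)).PosSemidef := by
  have hc : 0 ≤ c - b ^ 2 / a := by
    rw [sub_nonneg, div_le_iff₀ ha]
    linarith
  have h₁ := (hP.mul_mul_conjTranspose_same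
    (fromRows (1 : Matrix n n ℝ) ((b / a) • (1 : Matrix n n ℝ)))).smul ha.le
  have h₂ := (hP.mul_mul_conjTranspose_same
    (fromRows (0 : Matrix n n ℝ) (1 : Matrix n n ℝ))).smul hc
  convert h₁.add h₂ using 1
  rw [conjTranspose_fromRows_eq_fromCols_conjTranspose,
    conjTranspose_fromRows_eq_fromCols_conjTranspose]
  simp only [fromRows_mul]
  ext (i | i) (j | j) <;> simp <;> field_simp
  ring

/-- Lemma (eigenvalue bound for the continuous-time drift matrix `M_C`):
`M_C ⪰ (ρ/10)·(S + (1/(2ρ))·I)` whenever the Hessian `H` satisfies `−L_G·I ⪯ H ⪯ L_G·I`. -/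
theorem M_C_lower_bound {d : ℕ} (hd : 1 ≤ d) (L_G ρ : ℝ) (hLG : 0 < L_G)
    (hρ : 0 < ρ) (hρLG : ρ ≤ L_G)
    (H : Matrix (Fin d) (Fin d) ℝ) (hHsymm : H.IsSymm)
    (hHub : (L_G • (1 : Matrix (Fin d) (Fin d) ℝ) - H).PosSemidef)
    (hHlb : (H + L_G • (1 : Matrix (Fin d) (Fin d) ℝ)).PosSemidef) :
    (Matrix.fromBlocks
        (1 : Matrix (Fin d) (Fin d) ℝ)
        ((4 : ℝ) • (1 : Matrix (Fin d) (Fin d) ℝ) - (1 / (8 * L_G)) • H)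
        ((4 : ℝ) • (1 : Matrix (Fin d) (Fin d) ℝ) - (1 / (8 * L_G)) • H)
        ((18 : ℝ) • (1 : Matrix (Fin d) (Fin d) ℝ) - (1 / (2 * L_G)) • H)
      - (ρ / 10) • ((1 / L_G) • Matrix.fromBlocks
          ((1 / 4 : ℝ) • (1 : Matrix (Fin d) (Fin d) ℝ))
          ((1 / 2 : ℝ) • (1 : Matrix (Fin d) (Fin d) ℝ))
          ((1 / 2 : ℝ) • (1 : Matrix (Fin d) (Fin d) ℝ))
          ((2 : ℝ) • (1 : Matrix (Fin d) (Fin d) ℝ))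
        + (1 / (2 * ρ)) • (1 : Matrix (Fin d ⊕ Fin d) (Fin d ⊕ Fin d) ℝ))).PosSemidef := by
  have hr₀ : 0 < ρ / L_G := div_pos hρ hLG
  have hr₁ : ρ / L_G ≤ 1 := (div_le_one hLG).2 hρLG
  have hinv : 0 ≤ 1 / (2 * L_G) := by positivity
  have hub := (hHub.fromBlocks_smul (a := 19 / 20 - ρ / L_G / 40)
    (b := 33 / 8 - ρ / L_G / 20) (c := 369 / 20 - ρ / L_G / 5)
    (by linarith) (by nlinarith)).smul hinv
  have hlb := (hHlb.fromBlocks_smul (a := 19 / 20 - ρ / L_G / 40)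
    (b := 31 / 8 - ρ / L_G / 20) (c := 349 / 20 - ρ / L_G / 5)
    (by linarith) (by nlinarith)).smul hinv
  convert hub.add hlb using 1
  rw [← fromBlocks_one]
  ext (i | i) (j | j) <;> simp [-fromBlocks_one] <;> field_simp <;> ring
end

section
/- Let d ≥ 1, let ρ > 0 and L_G ≥ 2ρ, and let H be a d×d real symmetric matrix with −L_G·I_d ⪯ H ⪯ L_G·I_d. Define the 2d×2d block matrix M = [[(31/32)·I_d, 4·I_d − (1/(8L_G))·H], [4·I_d − (1/(8L_G))·H, (279/16)·I_d − (1/(2L_G))·H]]. Then M ⪰ (ρ/30)·(S + (1/(2ρ))·I_{2d}). -/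
open Matrix

/-- If a symmetric matrix `H` satisfies `-L • 1 ≤ H ≤ L • 1`, then `H * H ≤ L ^ 2 • 1`. -/
theorem posSemidef_sq_smul_one_sub_mul_self {n : Type*} [Fintype n] [DecidableEq n]
    {H : Matrix n n ℝ} {L : ℝ} (hL : 0 < L)
    (hub : (L • (1 : Matrix n n ℝ) - H).PosSemidef)
    (hlb : (H + L • (1 : Matrix n n ℝ)).PosSemidef) :
    (L ^ 2 • (1 : Matrix n n ℝ) - H * H).PosSemidef := by
  have h₁ := hub.conjTranspose_mul_mul_same (H + L • 1)
  have h₂ := hlb.conjTranspose_mul_mul_same (L • 1 - H)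
  rw [hlb.isHermitian.eq] at h₁
  rw [hub.isHermitian.eq] at h₂
  convert (h₁.add h₂).smul (inv_nonneg.2 (by positivity : (0 : ℝ) ≤ 2 * L)) using 1
  rw [eq_inv_smul_iff₀ (by positivity)]
  simp only [add_mul, mul_add, sub_mul, mul_sub, smul_mul_assoc, mul_smul_comm, one_mul, mul_one,
    mul_assoc]
  module

/-- A Schur complement criterion for a block matrix whose blocks are affine in a symmetric matrix
`H` with `-L • 1 ≤ H ≤ L • 1`. -/
theorem posSemidef_fromBlocks_affine {n : Type*} [Fintype n] [DecidableEq n]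
    {H : Matrix n n ℝ} {L : ℝ} (hL : 0 < L) (hH : H.IsSymm)
    (hub : (L • (1 : Matrix n n ℝ) - H).PosSemidef)
    (hlb : (H + L • (1 : Matrix n n ℝ)).PosSemidef)
    {a b c p q : ℝ} (ha : 0 < a) (hk : 0 ≤ 2 * b * p - a * q)
    (hdet : (b + p) ^ 2 ≤ a * (c + q)) :
    (fromBlocks (a • (1 : Matrix n n ℝ)) (b • (1 : Matrix n n ℝ) - (p / L) • H)
      (b • (1 : Matrix n n ℝ) - (p / L) • H) (c • (1 : Matrix n n ℝ) - (q / L) • H)).PosSemidef := by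
  have hA : (a • (1 : Matrix n n ℝ)).PosDef := PosDef.one.smul ha
  have hB : (b • (1 : Matrix n n ℝ) - (p / L) • H)ᴴ = b • (1 : Matrix n n ℝ) - (p / L) • H := by
    simp [conjTranspose_eq_transpose_of_trivial, hH.eq]
  let := hA.isUnit.invertible
  have hinv : (a • (1 : Matrix n n ℝ))⁻¹ = a⁻¹ • 1 :=
    inv_eq_left_inv (by simp [smul_smul, ha.ne'])
  have key := (PosDef.fromBlocks₁₁ (b • (1 : Matrix n n ℝ) - (p / L) • H)
    (c • (1 : Matrix n n ℝ) - (q / L) • H) hA).2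
  rw [hB] at key
  refine key ?_
  have h₀ : ((a * (c + q) - (b + p) ^ 2) • (1 : Matrix n n ℝ)).PosSemidef :=
    PosSemidef.one.smul (sub_nonneg.2 hdet)
  have h₁ := hlb.smul (div_nonneg hk hL.le)
  have h₂ := (posSemidef_sq_smul_one_sub_mul_self hL hub hlb).smul (sq_nonneg (p / L))
  convert ((h₀.add h₁).add h₂).smul (inv_nonneg.2 ha.le) using 1
  · rfl
  rw [hinv]
  simp only [sub_mul, mul_sub, smul_mul_assoc, mul_smul_comm, one_mul, mul_one]
  match_scalars <;> field_simp <;> ring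

/-- Lemma 4 (eigenvalue bound for the discretized drift matrix `M`):
`M ⪰ (ρ/30)·(S + (1/(2ρ))·I)` whenever `L_G ≥ 2ρ` and the Hessian `H`
satisfies `−L_G·I ⪯ H ⪯ L_G·I`. -/
theorem M_lower_bound {d : ℕ} (hd : 1 ≤ d) (L_G ρ : ℝ) (hρ : 0 < ρ) (hLG : 2 * ρ ≤ L_G)
    (H : Matrix (Fin d) (Fin d) ℝ) (hHsymm : H.IsSymm)
    (hHub : (L_G • (1 : Matrix (Fin d) (Fin d) ℝ) - H).PosSemidef)
    (hHlb : (H + L_G • (1 : Matrix (Fin d) (Fin d) ℝ)).PosSemidef) :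
    (Matrix.fromBlocks
        ((31 / 32 : ℝ) • (1 : Matrix (Fin d) (Fin d) ℝ))
        ((4 : ℝ) • (1 : Matrix (Fin d) (Fin d) ℝ) - (1 / (8 * L_G)) • H)
        ((4 : ℝ) • (1 : Matrix (Fin d) (Fin d) ℝ) - (1 / (8 * L_G)) • H)
        ((279 / 16 : ℝ) • (1 : Matrix (Fin d) (Fin d) ℝ) - (1 / (2 * L_G)) • H)
      - (ρ / 30) • ((1 / L_G) • Matrix.fromBlocks
          ((1 / 4 : ℝ) • (1 : Matrix (Fin d) (Fin d) ℝ))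
          ((1 / 2 : ℝ) • (1 : Matrix (Fin d) (Fin d) ℝ))
          ((1 / 2 : ℝ) • (1 : Matrix (Fin d) (Fin d) ℝ))
          ((2 : ℝ) • (1 : Matrix (Fin d) (Fin d) ℝ))
        + (1 / (2 * ρ)) • (1 : Matrix (Fin d ⊕ Fin d) (Fin d ⊕ Fin d) ℝ))).PosSemidef := by
  have hL : 0 < L_G := by linarith
  obtain ⟨r, rfl⟩ : ∃ r, ρ = r * L_G := ⟨ρ / L_G, by field_simp⟩
  have hr₀ : 0 < r := pos_of_mul_pos_left hρ hL.le
  have hr : r ≤ 1 / 2 := by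
    by_contra! h
    nlinarith
  convert posSemidef_fromBlocks_affine hL hHsymm hHub hHlb
    (a := 31 / 32 - r / 120 - 1 / 60) (b := 4 - r / 60) (c := 279 / 16 - r / 15 - 1 / 60)
    (p := 1 / 8) (q := 1 / 2) (by linarith) (by linarith) (by nlinarith) using 1
  rw [← fromBlocks_one, fromBlocks_smul, fromBlocks_smul, fromBlocks_add, fromBlocks_smul,
    sub_eq_add_neg, fromBlocks_neg, fromBlocks_add]
  congr 1 <;> match_scalars <;> field_simp <;> ring
end

section
/- Let d ≥ 1 and let m, L_G, R > 0 with m ≤ L_G. Let U : ℝ^d → ℝ be continuously differentiable with U(0) = 0, ∇U(0) = 0, and ∇U Lipschitz continuous with constant L_G. Assume U is m-strongly convex outside the ball B(0,R), in the sense that for all θ, ϑ ∈ ℝ^d such that the closed segment from ϑ to θ lies in ℝ^d ∖ B(0,R), one has U(θ) ≥ U(ϑ) + ⟨∇U(ϑ), θ − ϑ⟩ + (m/2)·‖θ − ϑ‖². Then ln( ∫_{ℝ^d} exp(−U(θ)) dθ ) ≤ (d/2)·ln(4π/m) + 32·(L_G²/m²)·L_G·R². -/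
open Real MeasureTheory
open scoped RealInnerProductSpace

/-- A `C¹` function vanishing to first order at the origin, with `L`-Lipschitz gradient, is bounded
below by `-L ‖x‖²`. -/
lemma neg_mul_sq_norm_le_of_lipschitz_gradient {E : Type*} [NormedAddCommGroup E]
    [InnerProductSpace ℝ E] [CompleteSpace E] {L : ℝ} (hL : 0 ≤ L) {U : E → ℝ}
    (hU : Differentiable ℝ U) (hU0 : U 0 = 0)
    (hgrad : ∀ x : E, ‖gradient U x‖ ≤ L * ‖x‖) (x : E) :
    -(L * ‖x‖ ^ 2) ≤ U x := by
  have hmv : ‖U x - U 0‖ ≤ L * ‖x‖ * ‖x - 0‖ := by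
    refine (convex_closedBall (0 : E) ‖x‖).norm_image_sub_le_of_norm_fderiv_le
      (fun y _ => hU y) (fun y hy => ?_) (by simp) (by simp)
    have hy' : ‖y‖ ≤ ‖x‖ := by simpa using hy
    have h : ‖fderiv ℝ U y‖ = ‖gradient U y‖ := by simp [gradient]
    rw [h]
    exact (hgrad y).trans (by gcongr)
  rw [hU0, sub_zero, sub_zero, Real.norm_eq_abs] at hmv
  nlinarith [(abs_le.mp hmv).1]

/-- A potential that is `m`-strongly convex outside a ball of radius `R` dominates a quadratic
function up to an additive constant. -/
lemma quadratic_lower_bound_of_strongConvex_outside_ball {E : Type*} [NormedAddCommGroup E]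
    [InnerProductSpace ℝ E] [CompleteSpace E] {m L R : ℝ}
    (hm : 0 < m) (hR : 0 < R) (hmL : m ≤ L) {U : E → ℝ}
    (hU : Differentiable ℝ U) (hU0 : U 0 = 0)
    (hgrad : ∀ x : E, ‖gradient U x‖ ≤ L * ‖x‖)
    (hconv : ∀ θ ϑ : E, segment ℝ ϑ θ ⊆ (Metric.closedBall (0 : E) R)ᶜ →
      U ϑ + ⟪gradient U ϑ, θ - ϑ⟫ + (m / 2) * ‖θ - ϑ‖ ^ 2 ≤ U θ) (x : E) :
    m / 4 * ‖x‖ ^ 2 - 32 * (L ^ 2 / m ^ 2) * L * R ^ 2 ≤ U x := by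
  have hL : 0 < L := hm.trans_le hmL
  have hlow := neg_mul_sq_norm_le_of_lipschitz_gradient hL.le hU hU0 hgrad
  set k := L / m with hk
  have hLk : L = k * m := by rw [hk]; field_simp
  have hk1 : 1 ≤ k := (one_le_div hm).mpr hmL
  have hconst : 32 * (L ^ 2 / m ^ 2) * L * R ^ 2 = 32 * k ^ 3 * (m * R ^ 2) := by
    rw [hk]; field_simp
  rw [hconst]
  have hmR : 0 < m * R ^ 2 := by positivity
  have hk2 : k ≤ k ^ 2 := by nlinarith
  have hk3 : k ^ 2 ≤ k ^ 3 := by nlinarith [sq_nonneg k]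
  rcases le_total ‖x‖ (2 * R) with hx | hx
  · have hsq : ‖x‖ ^ 2 ≤ 4 * R ^ 2 := by nlinarith [norm_nonneg x]
    have h := hlow x
    have h1 : (m / 4 + L) * ‖x‖ ^ 2 ≤ (m / 4 + L) * (4 * R ^ 2) := by gcongr
    have h2 : (m / 4 + L) * (4 * R ^ 2) = (1 + 4 * k) * (m * R ^ 2) := by rw [hLk]; ring
    have h3 : (1 + 4 * k) * (m * R ^ 2) ≤ 32 * k ^ 3 * (m * R ^ 2) := by gcongr; linarith
    linarith
  · have hx0 : 0 < ‖x‖ := by linarith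
    set c := 2 * R / ‖x‖ with hc
    have hc0 : 0 < c := by positivity
    have hc1 : c ≤ 1 := (div_le_one hx0).mpr hx
    have hcx : c * ‖x‖ = 2 * R := by rw [hc]; field_simp
    have hseg : segment ℝ (c • x) x ⊆ (Metric.closedBall (0 : E) R)ᶜ := by
      rintro y ⟨a, b, ha, hb, hab, rfl⟩
      have hy : a • c • x + b • x = (a * c + b) • x := by rw [smul_smul, add_smul]
      rw [hy, Set.mem_compl_iff, mem_closedBall_zero_iff, norm_smul, Real.norm_eq_abs,
        abs_of_nonneg (by positivity), not_le]
      have : c ≤ a * c + b := by nlinarith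
      nlinarith
    have hnc : ‖c • x‖ = 2 * R := by
      rw [norm_smul, Real.norm_eq_abs, abs_of_pos hc0, hcx]
    have hnd : ‖x - c • x‖ = ‖x‖ - 2 * R := by
      have : x - c • x = (1 - c) • x := by rw [sub_smul, one_smul]
      rw [this, norm_smul, Real.norm_eq_abs, abs_of_nonneg (by linarith), sub_mul, one_mul, hcx]
    have hmain := hconv x (c • x) hseg
    have hU' := hlow (c • x)
    have hinner : -(L * (2 * R) * (‖x‖ - 2 * R)) ≤ ⟪gradient U (c • x), x - c • x⟫ := by
      have h1 := (abs_le.mp (abs_real_inner_le_norm (gradient U (c • x)) (x - c • x))).1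
      have h2 := hgrad (c • x)
      rw [hnc] at h2
      rw [hnd] at h1
      have := mul_le_mul_of_nonneg_right h2 (sub_nonneg.mpr hx)
      linarith
    rw [hnd] at hmain
    rw [hnc] at hU'
    obtain ⟨t, ht⟩ : ∃ t, t = ‖x‖ - 2 * R := ⟨_, rfl⟩
    have hxt : ‖x‖ = t + 2 * R := by linarith
    rw [← ht] at hmain hinner
    rw [hxt]
    have h3 : (4 * k ^ 2 + 8 * k + 2) * (m * R ^ 2) ≤ 32 * k ^ 3 * (m * R ^ 2) := by
      gcongr; linarith
    rw [hLk] at hU' hinner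
    have h4 : 0 ≤ m * (t / 2 - (2 * k + 1) * R) ^ 2 := by positivity
    linarith

/-- Fact 1: bound on the normalization constant of the target density for a potential `U`
that is `m`-strongly convex outside the ball of radius `R`. -/
theorem log_normalization_bound {d : ℕ} (hd : 1 ≤ d) (m L_G R : ℝ)
    (hm : 0 < m) (hLG : 0 < L_G) (hR : 0 < R) (hmLG : m ≤ L_G)
    (U : EuclideanSpace ℝ (Fin d) → ℝ) (hU : ContDiff ℝ 1 U)
    (hU0 : U 0 = 0) (hgrad0 : gradient U 0 = 0)
    (hlip : ∀ θ ϑ : EuclideanSpace ℝ (Fin d),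
      ‖gradient U θ - gradient U ϑ‖ ≤ L_G * ‖θ - ϑ‖)
    (hconv : ∀ θ ϑ : EuclideanSpace ℝ (Fin d),
      segment ℝ ϑ θ ⊆ (Metric.closedBall (0 : EuclideanSpace ℝ (Fin d)) R)ᶜ →
      U ϑ + ⟪gradient U ϑ, θ - ϑ⟫ + (m / 2) * ‖θ - ϑ‖ ^ 2 ≤ U θ) :
    Real.log (∫ θ : EuclideanSpace ℝ (Fin d), Real.exp (-(U θ)))
      ≤ ((d : ℝ) / 2) * Real.log (4 * π / m) + 32 * (L_G ^ 2 / m ^ 2) * L_G * R ^ 2 := by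
  have hlow := quadratic_lower_bound_of_strongConvex_outside_ball hm hR hmLG
    (hU.differentiable one_ne_zero) hU0 (fun x => by simpa [hgrad0] using hlip x 0) hconv
  set C := 32 * (L_G ^ 2 / m ^ 2) * L_G * R ^ 2
  have hb : 0 < m / 4 := by positivity
  have hgauss : ∫ x : EuclideanSpace ℝ (Fin d), rexp (-(m / 4) * ‖x‖ ^ 2)
      = (4 * π / m) ^ ((d : ℝ) / 2) := by
    rw [GaussianFourier.integral_rexp_neg_mul_sq_norm hb, finrank_euclideanSpace_fin]
    congr 1
    field_simp
  have hpos : 0 < 4 * π / m := by positivity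
  have hint : Integrable fun x : EuclideanSpace ℝ (Fin d) => rexp (-(m / 4) * ‖x‖ ^ 2) := by
    by_contra h
    rw [integral_undef h] at hgauss
    exact (Real.rpow_pos_of_pos hpos _).ne hgauss
  have hle (x : EuclideanSpace ℝ (Fin d)) :
      rexp (-(U x)) ≤ rexp C * rexp (-(m / 4) * ‖x‖ ^ 2) := by
    rw [← Real.exp_add]
    exact Real.exp_le_exp.mpr (by linarith [hlow x])
  have hintU : Integrable fun x : EuclideanSpace ℝ (Fin d) => rexp (-(U x)) := by
    refine (hint.const_mul (rexp C)).mono'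
      (Real.continuous_exp.comp hU.continuous.neg).aestronglyMeasurable (.of_forall fun x => ?_)
    rw [Real.norm_eq_abs, Real.abs_exp]
    exact hle x
  calc Real.log (∫ x, rexp (-(U x)))
      ≤ Real.log (rexp C * (4 * π / m) ^ ((d : ℝ) / 2)) := by
        refine Real.log_le_log (integral_exp_pos hintU) ?_
        rw [← hgauss, ← integral_const_mul]
        exact integral_mono hintU (hint.const_mul _) hle
    _ = (d : ℝ) / 2 * Real.log (4 * π / m) + C := by
        rw [Real.log_mul (Real.exp_pos _).ne' (Real.rpow_pos_of_pos hpos _).ne', Real.log_exp,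
          Real.log_rpow hpos, add_comm]
end

section
/- Let d ≥ 1 and let m, L_G, R > 0 with m ≤ L_G. Let U : ℝ^d → ℝ be continuously differentiable with U(0) = 0, ∇U(0) = 0, and ∇U Lipschitz continuous with constant L_G. Assume that for all θ, ϑ ∈ ℝ^d such that the closed segment from ϑ to θ lies in ℝ^d ∖ B(0,R), one has U(θ) ≥ U(ϑ) + ⟨∇U(ϑ), θ − ϑ⟩ + (m/2)·‖θ − ϑ‖². Then for every θ ∈ ℝ^d with ‖θ‖ ≥ (8L_G/m)·R, one has U(θ) ≥ (m/4)·‖θ‖². -/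
open Real
open scoped RealInnerProductSpace

/-- A function vanishing at the origin whose gradient grows at most linearly is bounded
below by a negative quadratic. -/
lemma neg_mul_sq_norm_le_of_norm_gradient_le {E : Type*} [NormedAddCommGroup E]
    [InnerProductSpace ℝ E] [CompleteSpace E] {U : E → ℝ} {L : ℝ} (hL : 0 ≤ L)
    (hU : Differentiable ℝ U) (hU0 : U 0 = 0) (hgrad : ∀ x, ‖gradient U x‖ ≤ L * ‖x‖) (x : E) :
    -(L * ‖x‖ ^ 2) ≤ U x := by
  have key := (convex_closedBall (0 : E) ‖x‖).norm_image_sub_le_of_norm_fderiv_le (𝕜 := ℝ)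
    (f := U) (C := L * ‖x‖) (x := 0) (y := x) (fun y _ => hU y)
    (fun y hy => by
      have hnorm : ‖gradient U y‖ = ‖fderiv ℝ U y‖ := by simp [gradient]
      have hy' : ‖y‖ ≤ ‖x‖ := by simpa using hy
      rw [← hnorm]
      exact (hgrad y).trans (by gcongr))
    (by simp) (by simp)
  rw [hU0, sub_zero, sub_zero, Real.norm_eq_abs] at key
  nlinarith [neg_abs_le (U x)]

/-- The segment from `c • x` to `x`, for `c ≤ 1`, avoids any centred ball of radius less than
`c * ‖x‖`. -/
lemma segment_smul_subset_compl_closedBall {E : Type*} [NormedAddCommGroup E] [NormedSpace ℝ E]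
    {x : E} {c R : ℝ} (hc : c ≤ 1) (hR : R < c * ‖x‖) :
    segment ℝ (c • x) x ⊆ (Metric.closedBall (0 : E) R)ᶜ := by
  rintro _ ⟨a, b, ha, hb, hab, rfl⟩
  have hle : c ≤ a * c + b := by nlinarith
  have hcomb : a • c • x + b • x = (a * c + b) • x := by module
  simp only [Set.mem_compl_iff, mem_closedBall_zero_iff, not_le]
  rw [hcomb, norm_smul, Real.norm_eq_abs]
  calc R < c * ‖x‖ := hR
    _ ≤ |a * c + b| * ‖x‖ := by gcongr; exact hle.trans (le_abs_self _)

/-- Quadratic-growth estimate from the proof of Fact 1: a potential that is `m`-strongly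
convex outside the ball of radius `R` grows at least like `(m/4)·‖θ‖²` for
`‖θ‖ ≥ (8·L_G/m)·R`. -/
theorem quadratic_growth {d : ℕ} (hd : 1 ≤ d) (m L_G R : ℝ)
    (hm : 0 < m) (hLG : 0 < L_G) (hR : 0 < R) (hmLG : m ≤ L_G)
    (U : EuclideanSpace ℝ (Fin d) → ℝ) (hU : ContDiff ℝ 1 U)
    (hU0 : U 0 = 0) (hgrad0 : gradient U 0 = 0)
    (hlip : ∀ θ ϑ : EuclideanSpace ℝ (Fin d),
      ‖gradient U θ - gradient U ϑ‖ ≤ L_G * ‖θ - ϑ‖)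
    (hconv : ∀ θ ϑ : EuclideanSpace ℝ (Fin d),
      segment ℝ ϑ θ ⊆ (Metric.closedBall (0 : EuclideanSpace ℝ (Fin d)) R)ᶜ →
      U ϑ + ⟪gradient U ϑ, θ - ϑ⟫ + (m / 2) * ‖θ - ϑ‖ ^ 2 ≤ U θ) :
    ∀ θ : EuclideanSpace ℝ (Fin d), (8 * L_G / m) * R ≤ ‖θ‖ →
      (m / 4) * ‖θ‖ ^ 2 ≤ U θ := by
  intro θ hθ
  have hgrad (x : EuclideanSpace ℝ (Fin d)) : ‖gradient U x‖ ≤ L_G * ‖x‖ := by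
    simpa [hgrad0] using hlip x 0
  have hmt : 8 * L_G * R ≤ m * ‖θ‖ := by
    rw [div_mul_eq_mul_div, div_le_iff₀ hm] at hθ
    linarith
  have hRt : R < ‖θ‖ := by
    have : m * R ≤ L_G * R := by gcongr
    have : 0 < L_G * R := by positivity
    refine lt_of_mul_lt_mul_left ?_ hm.le
    linarith
  have ht : 0 < ‖θ‖ := hR.trans hRt
  have bound : ∀ r ∈ Set.Ioo R ‖θ‖,
      -(L_G * r * ‖θ‖) + m / 2 * (‖θ‖ - r) ^ 2 ≤ U θ := by
    rintro r ⟨hRr, hrt⟩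
    have hr : 0 < r := hR.trans hRr
    set c := r / ‖θ‖ with hc
    have hct : c * ‖θ‖ = r := div_mul_cancel₀ r ht.ne'
    have hc0 : 0 ≤ c := by positivity
    have hc1 : c ≤ 1 := (div_le_one ht).2 hrt.le
    have hnorm : ‖c • θ‖ = r := by rw [norm_smul, Real.norm_of_nonneg hc0, hct]
    have hdiff : ‖θ - c • θ‖ = ‖θ‖ - r := by
      rw [show θ - c • θ = (1 - c) • θ by module, norm_smul,
        Real.norm_of_nonneg (sub_nonneg.2 hc1), sub_mul, one_mul, hct]
    have hconv' := hconv θ (c • θ) (segment_smul_subset_compl_closedBall hc1 (hRr.trans_eq hct.symm))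
    have hlow := neg_mul_sq_norm_le_of_norm_gradient_le hLG.le (hU.differentiable one_ne_zero)
      hU0 hgrad (c • θ)
    have hinner : -(L_G * r * (‖θ‖ - r)) ≤ ⟪gradient U (c • θ), θ - c • θ⟫ := by
      refine neg_le_of_abs_le ((abs_real_inner_le_norm _ _).trans ?_)
      rw [hdiff]
      have := hgrad (c • θ)
      rw [hnorm] at this
      exact mul_le_mul_of_nonneg_right this (sub_nonneg.2 hrt.le)
    rw [hdiff] at hconv'
    rw [hnorm] at hlow
    linarith
  have boundR : -(L_G * R * ‖θ‖) + m / 2 * (‖θ‖ - R) ^ 2 ≤ U θ := by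
    have hmem : R ∈ closure (Set.Ioo R ‖θ‖) := by
      rw [closure_Ioo hRt.ne]
      exact Set.left_mem_Icc.2 hRt.le
    exact le_on_closure (f := fun r => -(L_G * r * ‖θ‖) + m / 2 * (‖θ‖ - r) ^ 2)
      (g := fun _ => U θ) bound (by fun_prop) (by fun_prop) hmem
  have h₁ : 8 * L_G * R * ‖θ‖ ≤ m * ‖θ‖ * ‖θ‖ := by gcongr
  have h₂ : m * (R * ‖θ‖) ≤ L_G * (R * ‖θ‖) := by gcongr
  have h₃ : 0 ≤ m * R ^ 2 := by positivity
  linarith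
end

section
/- Let d ≥ 1, let L_G, γ, ξ > 0, and let ν be a real number with 0 ≤ ν ≤ min{ 1/(γξ), 1/√(2e·L_G·ξ) }. Let H be a d×d real symmetric matrix with spectral norm ‖H‖₂ ≤ L_G, and set η = (1/γ)·( e^{γξν}(1 − e^{−γξν})²/(γξ) − ( ν − (1 − e^{−γξν})/(γξ) ) ). Then the matrix I_d + η·H is invertible, and the 2d×d stacked matrix whose top d×d block is H·((I_d + η·H)^{−1} − I_d) and whose bottom d×d block is −((e^{γξν} − 1)/γ)·H·(I_d + η·H)^{−1} has spectral norm at most 4e·max{ L_G²·ξ·ν², L_G·ξ·ν }. -/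
open Real Matrix

lemma norm_toLp_sum_elim_le {m n : Type*} [Fintype m] [Fintype n] (a : m → ℝ) (b : n → ℝ) :
    ‖WithLp.toLp 2 (Sum.elim a b)‖ ≤ ‖WithLp.toLp 2 a‖ + ‖WithLp.toLp 2 b‖ := by
  refine abs_le_of_sq_le_sq' ?_ (by positivity) |>.2
  have h : ‖WithLp.toLp 2 (Sum.elim a b)‖ ^ 2
      = ‖WithLp.toLp 2 a‖ ^ 2 + ‖WithLp.toLp 2 b‖ ^ 2 := by
    simp [EuclideanSpace.norm_sq_eq, Fintype.sum_sum_type]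
  rw [h]
  nlinarith [mul_nonneg (norm_nonneg (WithLp.toLp 2 a)) (norm_nonneg (WithLp.toLp 2 b))]

lemma norm_toLp_le_of_one_add_smul_mulVec {n : Type*} [Fintype n] [DecidableEq n]
    {H : Matrix n n ℝ} {L η : ℝ} (hη : 0 ≤ η)
    (hH : ∀ v : n → ℝ, ‖WithLp.toLp 2 (H *ᵥ v)‖ ≤ L * ‖WithLp.toLp 2 v‖) (v : n → ℝ) :
    (1 - η * L) * ‖WithLp.toLp 2 v‖ ≤ ‖WithLp.toLp 2 ((1 + η • H) *ᵥ v)‖ := by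
  have h : WithLp.toLp 2 v
      = WithLp.toLp 2 ((1 + η • H) *ᵥ v) - η • WithLp.toLp 2 (H *ᵥ v) := by
    ext i
    simp [add_mulVec, smul_mulVec]
  have h₁ := norm_sub_le (WithLp.toLp 2 ((1 + η • H) *ᵥ v)) (η • WithLp.toLp 2 (H *ᵥ v))
  rw [← h, norm_smul, Real.norm_of_nonneg hη] at h₁
  nlinarith [mul_le_mul_of_nonneg_left (hH v) hη]

lemma isUnit_one_add_smul_of_norm_mulVec_le {n : Type*} [Fintype n] [DecidableEq n]
    {H : Matrix n n ℝ} {L η : ℝ} (hη : 0 ≤ η) (hηL : η * L < 1)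
    (hH : ∀ v : n → ℝ, ‖WithLp.toLp 2 (H *ᵥ v)‖ ≤ L * ‖WithLp.toLp 2 v‖) :
    IsUnit (1 + η • H) := by
  rw [← mulVec_injective_iff_isUnit]
  intro v w hvw
  have h := norm_toLp_le_of_one_add_smul_mulVec hη hH (v - w)
  have h₀ : (1 + η • H) *ᵥ (v - w) = 0 := by
    rw [mulVec_sub]
    exact sub_eq_zero.mpr hvw
  rw [h₀, WithLp.toLp_zero, norm_zero] at h
  have h₁ : ‖WithLp.toLp 2 (v - w)‖ = 0 :=
    le_antisymm (nonpos_of_mul_nonpos_right h (by linarith)) (norm_nonneg _)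
  rw [norm_eq_zero, WithLp.toLp_eq_zero] at h₁
  exact sub_eq_zero.mp h₁

lemma disc_step_bounds {γ ξ ν η : ℝ} (hγ : 0 < γ) (hξ : 0 < ξ) (hν : 0 ≤ ν)
    (hνle : ν ≤ 1 / (γ * ξ))
    (hη : η = (1 / γ) * (Real.exp (γ * ξ * ν) * (1 - Real.exp (-(γ * ξ * ν))) ^ 2 / (γ * ξ)
        - (ν - (1 - Real.exp (-(γ * ξ * ν))) / (γ * ξ)))) :
    0 ≤ η ∧ η ≤ ξ * ν ^ 2 ∧
      0 ≤ (Real.exp (γ * ξ * ν) - 1) / γ ∧ (Real.exp (γ * ξ * ν) - 1) / γ ≤ 2 * (ξ * ν) := by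
  have hγξ : 0 < γ * ξ := mul_pos hγ hξ
  have ht1 : γ * ξ * ν ≤ 1 := by
    rw [le_div_iff₀ hγξ] at hνle
    linarith
  have ht0 : 0 ≤ γ * ξ * ν := by positivity
  have hη' : η = (Real.exp (γ * ξ * ν) - 1 - γ * ξ * ν) / (γ ^ 2 * ξ) := by
    rw [hη, Real.exp_neg]
    have := Real.exp_ne_zero (γ * ξ * ν)
    field_simp
    ring
  have hlow := Real.add_one_le_exp (γ * ξ * ν)
  have hup := Real.abs_exp_sub_one_sub_id_le (x := γ * ξ * ν) (by rwa [abs_of_nonneg ht0])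
  rw [abs_of_nonneg (by linarith)] at hup
  refine ⟨?_, ?_, div_nonneg (by linarith) hγ.le, ?_⟩
  · rw [hη']
    exact div_nonneg (by linarith) (by positivity)
  · rw [hη', div_le_iff₀ (by positivity)]
    linarith
  · rw [div_le_iff₀ hγ]
    nlinarith

lemma mul_sq_le_quarter {L ξ ν : ℝ} (hL : 0 < L) (hξ : 0 < ξ) (hν : 0 ≤ ν)
    (hνle : ν ≤ 1 / Real.sqrt (2 * Real.exp 1 * L * ξ)) : ξ * ν ^ 2 * L ≤ 1 / 4 := by
  have hpos : 0 < 2 * Real.exp 1 * L * ξ := by positivity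
  have h := pow_le_pow_left₀ hν hνle 2
  rw [div_pow, Real.sq_sqrt hpos.le, one_pow, le_div_iff₀ hpos] at h
  have he : 2 ≤ Real.exp 1 := by linarith [Real.add_one_le_exp (1 : ℝ)]
  nlinarith [mul_le_mul_of_nonneg_right he (show 0 ≤ ξ * ν ^ 2 * L by positivity)]

/-- Fact 2: spectral-norm bound on the matrix controlling the discretization error of one
step of the underdamped Langevin algorithm.  The spectral norm of a matrix `A` is
expressed by the operator bound `‖A·x‖ ≤ c·‖x‖` with respect to Euclidean norms. -/
theorem disc_matrix_norm_bound {d : ℕ} (hd : 1 ≤ d) (L_G γ ξ ν : ℝ)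
    (hLG : 0 < L_G) (hγ : 0 < γ) (hξ : 0 < ξ) (hν0 : 0 ≤ ν)
    (hνub : ν ≤ min (1 / (γ * ξ)) (1 / Real.sqrt (2 * Real.exp 1 * L_G * ξ)))
    (H : Matrix (Fin d) (Fin d) ℝ) (hHsymm : H.IsSymm)
    (hHnorm : ∀ x : EuclideanSpace ℝ (Fin d),
      ‖(EuclideanSpace.equiv (Fin d) ℝ).symm (H *ᵥ (EuclideanSpace.equiv (Fin d) ℝ x))‖
        ≤ L_G * ‖x‖)
    (η : ℝ)
    (hη : η = (1 / γ) * (Real.exp (γ * ξ * ν) * (1 - Real.exp (-(γ * ξ * ν))) ^ 2 / (γ * ξ)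
        - (ν - (1 - Real.exp (-(γ * ξ * ν))) / (γ * ξ)))) :
    IsUnit (1 + η • H) ∧
      ∀ x : EuclideanSpace ℝ (Fin d),
        ‖(EuclideanSpace.equiv (Fin d ⊕ Fin d) ℝ).symm
            ((Matrix.fromRows
                (H * ((1 + η • H)⁻¹ - 1))
                (-(((Real.exp (γ * ξ * ν) - 1) / γ) • (H * (1 + η • H)⁻¹))))
              *ᵥ (EuclideanSpace.equiv (Fin d) ℝ x))‖
          ≤ 4 * Real.exp 1 * max (L_G ^ 2 * ξ * ν ^ 2) (L_G * ξ * ν) * ‖x‖ := by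
  have hH : ∀ v : Fin d → ℝ, ‖WithLp.toLp 2 (H *ᵥ v)‖ ≤ L_G * ‖WithLp.toLp 2 v‖ :=
    fun v ↦ hHnorm (WithLp.toLp 2 v)
  obtain ⟨hη0, hηle, hc0, hcle⟩ :=
    disc_step_bounds hγ hξ hν0 (hνub.trans (min_le_left _ _)) hη
  have hquarter := mul_sq_le_quarter hLG hξ hν0 (hνub.trans (min_le_right _ _))
  have hηL : η * L_G ≤ 1 / 4 := (mul_le_mul_of_nonneg_right hηle hLG.le).trans hquarter
  have hunit : IsUnit (1 + η • H) :=
    isUnit_one_add_smul_of_norm_mulVec_le hη0 (by linarith) hH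
  refine ⟨hunit, fun x ↦ ?_⟩
  set c := (Real.exp (γ * ξ * ν) - 1) / γ
  set y : Fin d → ℝ := (1 + η • H)⁻¹ *ᵥ x.ofLp with hy
  have hyx : (1 + η • H) *ᵥ y = x.ofLp := by
    rw [hy, mulVec_mulVec, mul_nonsing_inv _ ((isUnit_iff_isUnit_det _).mp hunit), one_mulVec]
  have hynorm : ‖WithLp.toLp 2 y‖ ≤ 4 / 3 * ‖x‖ := by
    have h := norm_toLp_le_of_one_add_smul_mulVec hη0 hH y
    rw [hyx, WithLp.toLp_ofLp] at h
    nlinarith [mul_le_mul_of_nonneg_right hηL (norm_nonneg (WithLp.toLp 2 y))]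
  have htop : (H * ((1 + η • H)⁻¹ - 1)) *ᵥ x.ofLp = -(η • (H *ᵥ (H *ᵥ y))) := by
    rw [← mulVec_mulVec, sub_mulVec, one_mulVec, ← hy, ← hyx]
    rw [add_mulVec, one_mulVec, smul_mulVec, sub_add_cancel_left, mulVec_neg, mulVec_smul]
  have hbot : (-(c • (H * (1 + η • H)⁻¹))) *ᵥ x.ofLp = -(c • (H *ᵥ y)) := by
    rw [neg_mulVec, smul_mulVec, ← mulVec_mulVec]
  have hHy : ‖WithLp.toLp 2 (H *ᵥ y)‖ ≤ L_G * (4 / 3 * ‖x‖) :=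
    (hH y).trans (by gcongr)
  have htopnorm : ‖WithLp.toLp 2 (-(η • (H *ᵥ (H *ᵥ y))))‖
      ≤ 4 / 3 * (L_G ^ 2 * ξ * ν ^ 2) * ‖x‖ := by
    rw [WithLp.toLp_neg, WithLp.toLp_smul, norm_neg, norm_smul, Real.norm_of_nonneg hη0]
    calc η * ‖WithLp.toLp 2 (H *ᵥ (H *ᵥ y))‖
        ≤ (ξ * ν ^ 2) * (L_G * (L_G * (4 / 3 * ‖x‖))) := by
          gcongr
          exact (hH _).trans (by gcongr)
      _ = _ := by ring
  have hbotnorm : ‖WithLp.toLp 2 (-(c • (H *ᵥ y)))‖ ≤ 8 / 3 * (L_G * ξ * ν) * ‖x‖ := by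
    rw [WithLp.toLp_neg, WithLp.toLp_smul, norm_neg, norm_smul, Real.norm_of_nonneg hc0]
    calc c * ‖WithLp.toLp 2 (H *ᵥ y)‖
        ≤ (2 * (ξ * ν)) * (L_G * (4 / 3 * ‖x‖)) := by gcongr
      _ = _ := by ring
  change ‖WithLp.toLp 2 (Matrix.fromRows _ _ *ᵥ x.ofLp)‖ ≤ _
  rw [fromRows_mulVec, htop, hbot]
  refine (norm_toLp_sum_elim_le _ _).trans ((add_le_add htopnorm hbotnorm).trans ?_)
  rw [← add_mul]
  gcongr
  set M := max (L_G ^ 2 * ξ * ν ^ 2) (L_G * ξ * ν)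
  have h₁ : L_G ^ 2 * ξ * ν ^ 2 ≤ M := le_max_left _ _
  have h₂ : L_G * ξ * ν ≤ M := le_max_right _ _
  have hM : 0 ≤ M := le_trans (by positivity) h₂
  have he : 1 ≤ Real.exp 1 := by linarith [Real.add_one_le_exp (1 : ℝ)]
  nlinarith [mul_le_mul_of_nonneg_right he hM]
end

section
/- Let d ≥ 1 and L_G > 0, and let p₀(θ) = (L_G/(2π))^{d/2}·exp(−(L_G/2)‖θ‖²) be the density of the Gaussian N(0, (1/L_G)·I_d) on ℝ^d. Let U : ℝ^d → ℝ be continuous with |U(θ)| ≤ (L_G/2)‖θ‖² for all θ, suppose Z := ∫_{ℝ^d} exp(−U(θ)) dθ is finite, and suppose ln Z ≤ C_N·d + C_M for real constants C_N, C_M. Let p*(θ) = exp(−U(θ))/Z. Then the Kullback–Leibler divergence satisfies ∫_{ℝ^d} p₀(θ)·ln( p₀(θ)/p*(θ) ) dθ ≤ ( C_N + (1/2)·ln(L_G/(2π)) )·d + C_M. -/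
open Real MeasureTheory

theorem integrable_exp_neg_mul_sq_norm {d : ℕ} {b : ℝ} (hb : 0 < b) :
    Integrable (fun θ : EuclideanSpace ℝ (Fin d) => Real.exp (-b * ‖θ‖ ^ 2)) := by
  apply Integrable.of_integral_ne_zero
  rw [GaussianFourier.integral_rexp_neg_mul_sq_norm hb]
  positivity

theorem integral_gaussianDensity {d : ℕ} {L : ℝ} (hL : 0 < L) :
    ∫ θ : EuclideanSpace ℝ (Fin d),
      (L / (2 * π)) ^ ((d : ℝ) / 2) * Real.exp (-(L / 2) * ‖θ‖ ^ 2) = 1 := by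
  rw [integral_const_mul, GaussianFourier.integral_rexp_neg_mul_sq_norm (half_pos hL),
    finrank_euclideanSpace_fin, ← Real.mul_rpow (by positivity) (by positivity)]
  have h : L / (2 * π) * (π / (L / 2)) = 1 := by field_simp
  rw [h, Real.one_rpow]

theorem integrable_exp_neg_mul_sq_norm_mul {d : ℕ} {b C D : ℝ} (hb : 0 < b)
    {g : EuclideanSpace ℝ (Fin d) → ℝ} (hg : Continuous g)
    (hgb : ∀ θ, |g θ| ≤ C + D * ‖θ‖ ^ 2) :
    Integrable (fun θ => Real.exp (-b * ‖θ‖ ^ 2) * g θ) := by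
  have hdom := ((integrable_exp_neg_mul_sq_norm (d := d) hb).mul_const C).add
    ((integrable_exp_neg_mul_sq_norm (d := d) (half_pos hb)).mul_const (|D| * (2 / b)))
  refine hdom.mono' (by fun_prop) (Filter.Eventually.of_forall fun θ => ?_)
  have hsq : ‖θ‖ ^ 2 ≤ 2 / b * Real.exp (b / 2 * ‖θ‖ ^ 2) := by
    have h := Real.add_one_le_exp (b / 2 * ‖θ‖ ^ 2)
    calc ‖θ‖ ^ 2 = 2 / b * (b / 2 * ‖θ‖ ^ 2) := by field_simp
      _ ≤ _ := by gcongr; linarith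
  have hsplit : Real.exp (-b * ‖θ‖ ^ 2) * Real.exp (b / 2 * ‖θ‖ ^ 2)
      = Real.exp (-(b / 2) * ‖θ‖ ^ 2) := by
    rw [← Real.exp_add]; ring_nf
  rw [Real.norm_eq_abs, abs_mul, Real.abs_exp, Pi.add_apply]
  calc Real.exp (-b * ‖θ‖ ^ 2) * |g θ|
      ≤ Real.exp (-b * ‖θ‖ ^ 2) * (C + |D| * (2 / b * Real.exp (b / 2 * ‖θ‖ ^ 2))) := by
        gcongr
        refine (hgb θ).trans ?_
        gcongr
        exact le_abs_self D
    _ = _ := by rw [← hsplit]; ring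

/-- Part (a) of Lemma 5: KL divergence of the initial Gaussian `N(0, (1/L_G)·I_d)` from
the target `p*(θ) = exp(−U(θ))/Z` is at most `(C_N + (1/2)·ln(L_G/(2π)))·d + C_M`. -/
theorem initial_KL_bound {d : ℕ} (hd : 1 ≤ d) (L_G C_N C_M : ℝ) (hLG : 0 < L_G)
    (U : EuclideanSpace ℝ (Fin d) → ℝ) (hUc : Continuous U)
    (hUb : ∀ θ : EuclideanSpace ℝ (Fin d), |U θ| ≤ (L_G / 2) * ‖θ‖ ^ 2)
    (hint : Integrable (fun θ : EuclideanSpace ℝ (Fin d) => Real.exp (-(U θ))))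
    (hZ : Real.log (∫ θ : EuclideanSpace ℝ (Fin d), Real.exp (-(U θ))) ≤ C_N * d + C_M) :
    ∫ θ : EuclideanSpace ℝ (Fin d),
        ((L_G / (2 * π)) ^ ((d : ℝ) / 2) * Real.exp (-(L_G / 2) * ‖θ‖ ^ 2))
          * Real.log (((L_G / (2 * π)) ^ ((d : ℝ) / 2) * Real.exp (-(L_G / 2) * ‖θ‖ ^ 2))
              / (Real.exp (-(U θ)) / (∫ ϑ : EuclideanSpace ℝ (Fin d), Real.exp (-(U ϑ)))))
      ≤ (C_N + (1 / 2) * Real.log (L_G / (2 * π))) * d + C_M := by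
  set Z := ∫ θ : EuclideanSpace ℝ (Fin d), Real.exp (-(U θ))
  have hZpos : 0 < Z := integral_exp_pos hint
  set A := (L_G / (2 * π)) ^ ((d : ℝ) / 2)
  have hApos : 0 < A := by positivity
  have hlogA : Real.log A = d / 2 * Real.log (L_G / (2 * π)) :=
    Real.log_rpow (by positivity) _
  have hlog (θ : EuclideanSpace ℝ (Fin d)) :
      Real.log ((A * Real.exp (-(L_G / 2) * ‖θ‖ ^ 2)) / (Real.exp (-(U θ)) / Z))
        = Real.log A + Real.log Z + (U θ - L_G / 2 * ‖θ‖ ^ 2) := by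
    rw [Real.log_div (by positivity) (by positivity), Real.log_mul (by positivity) (by positivity),
      Real.log_div (by positivity) (by positivity), Real.log_exp, Real.log_exp]
    ring
  simp_rw [hlog]
  have hbound (θ : EuclideanSpace ℝ (Fin d)) :
      |Real.log A + Real.log Z + (U θ - L_G / 2 * ‖θ‖ ^ 2)|
        ≤ |Real.log A + Real.log Z| + L_G * ‖θ‖ ^ 2 := by
    refine (abs_add_le _ _).trans ?_
    gcongr
    obtain ⟨h₁, h₂⟩ := abs_le.mp (hUb θ)
    rw [abs_le]
    constructor <;> nlinarith [mul_nonneg hLG.le (sq_nonneg ‖θ‖)]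
  have hintegrable : Integrable (fun θ : EuclideanSpace ℝ (Fin d) =>
      A * Real.exp (-(L_G / 2) * ‖θ‖ ^ 2)
        * (Real.log A + Real.log Z + (U θ - L_G / 2 * ‖θ‖ ^ 2))) := by
    simp_rw [mul_assoc A]
    exact (integrable_exp_neg_mul_sq_norm_mul (half_pos hLG) (by fun_prop) hbound).const_mul A
  calc _ ≤ ∫ θ : EuclideanSpace ℝ (Fin d),
        A * Real.exp (-(L_G / 2) * ‖θ‖ ^ 2) * (Real.log A + Real.log Z) := by
        refine integral_mono hintegrable
          (((integrable_exp_neg_mul_sq_norm (half_pos hLG)).const_mul A).mul_const _) fun θ => ?_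
        have := (le_abs_self _).trans (hUb θ)
        exact mul_le_mul_of_nonneg_left (by linarith) (by positivity)
    _ = Real.log A + Real.log Z := by
        rw [integral_mul_const, integral_gaussianDensity hLG, one_mul]
    _ ≤ _ := by rw [hlogA]; linarith
end
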